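/- Let k > 0, μ > 0, and x₁,x₂ ≥ 0. Then Σ_{m=0}^∞ (1/((μ)_m m!)) · P_{m,0}(x₁,x₂)/P_{m,0}(1,1) = (Γ(k+1/2)/(Γ(k)√π)) ∫_{−1}^{1} 𝓘_{μ−1}(√(2(x₁+x₂+v(x₁−x₂)))) (1−v²)^{k−1} dv, where (μ)_m = μ(μ+1)⋯(μ+m−1) = Γ(μ+m)/Γ(μ) is the Pochhammer symbol. Note that P_{m,0}(x₁,x₂)/P_{m,0}(1,1) = (Γ(k+1/2)/(√π Γ(k))) ∫_{−1}^{1} ((x₁+x₂)/2 + u(x₁−x₂)/2)^m (1−u²)^{k−1} du. -/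

import Mathlib

open Real

/-- Integral representation of the two-variable Jack polynomial `P_{(m+ℓ, ℓ)}`
with parameter `k > 0`. -/
noncomputable def JackP (k : ℝ) (m ℓ : ℕ) (x₁ x₂ : ℝ) : ℝ :=
  (Real.Gamma (m + 2 * k) / ((2 : ℝ) ^ (2 * k - 1) * Real.Gamma k * Real.Gamma (m + k))) *
    ((x₁ * x₂) ^ ℓ *
      ∫ u in (-1 : ℝ)..1, ((x₁ + x₂) / 2 + u * (x₁ - x₂) / 2) ^ m * (1 - u ^ 2) ^ (k - 1))

/-- The Laplace–Beltrami-type operator `Λ_k`. -/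
noncomputable def Lam (k : ℝ) (f : ℝ → ℝ → ℝ) (x₁ x₂ : ℝ) : ℝ :=
  x₁ ^ 2 * deriv (deriv (fun s => f s x₂)) x₁ +
    x₂ ^ 2 * deriv (deriv (fun s => f x₁ s)) x₂ +
    2 * k * (x₁ ^ 2 / (x₁ - x₂) * deriv (fun s => f s x₂) x₁ +
      x₂ ^ 2 / (x₂ - x₁) * deriv (fun s => f x₁ s) x₂)

/-- The normalized modified Bessel function of the first kind,
`𝓘_ν(t) = Γ(ν+1) Σ_{m≥0} (t/2)^{2m}/(m! Γ(m+ν+1))`. -/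
noncomputable def besselI (ν t : ℝ) : ℝ :=
  Real.Gamma (ν + 1) *
    ∑' m : ℕ, (t / 2) ^ (2 * m) / ((m.factorial : ℝ) * Real.Gamma (m + ν + 1))


lemma aux_betaReal (k : ℝ) (hk : 0 < k) :
    ∫ x in (0 : ℝ)..1, x ^ (k - 1) * (1 - x) ^ (k - 1) =
      Real.Gamma k * Real.Gamma k / Real.Gamma (2 * k) := by
  have h := Complex.betaIntegral_eq_Gamma_mul_div (k : ℂ) (k : ℂ) (by simpa) (by simpa)
  have h2 : Complex.betaIntegral (k : ℂ) (k : ℂ) =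
      ((∫ x in (0 : ℝ)..1, x ^ (k - 1) * (1 - x) ^ (k - 1) : ℝ) : ℂ) := by
    rw [Complex.betaIntegral, ← intervalIntegral.integral_ofReal]
    apply intervalIntegral.integral_congr
    intro x hx
    rw [Set.uIcc_of_le zero_le_one] at hx
    simp only
    rw [Complex.ofReal_mul, Complex.ofReal_cpow hx.1, Complex.ofReal_cpow (by linarith [hx.2])]
    push_cast
    rfl
  rw [h2, ← Complex.ofReal_add, Complex.Gamma_ofReal, Complex.Gamma_ofReal] at h
  rw [two_mul]
  exact_mod_cast h

lemma aux_B (k : ℝ) (hk : 0 < k) :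
    ∫ u in (-1 : ℝ)..1, (1 - u ^ 2) ^ (k - 1) =
      Real.sqrt Real.pi * Real.Gamma k / Real.Gamma (k + 1 / 2) := by
  have h := intervalIntegral.smul_integral_comp_mul_add (a := 0) (b := 1)
    (fun u : ℝ => (1 - u ^ 2) ^ (k - 1)) 2 (-1)
  norm_num at h
  rw [← h]
  have h3 : ∫ x in (0 : ℝ)..1, (1 - (2 * x + -1) ^ 2) ^ (k - 1) =
      4 ^ (k - 1) * ∫ x in (0 : ℝ)..1, x ^ (k - 1) * (1 - x) ^ (k - 1) := by
    rw [← intervalIntegral.integral_const_mul]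
    apply intervalIntegral.integral_congr
    intro x hx
    rw [Set.uIcc_of_le zero_le_one] at hx
    simp only
    have h1 : 0 ≤ 1 - x := by linarith [hx.2]
    rw [← Real.mul_rpow hx.1 h1, ← Real.mul_rpow (by norm_num) (mul_nonneg hx.1 h1)]
    congr 1
    ring
  rw [h3, aux_betaReal k hk]
  have h4 := Real.Gamma_mul_Gamma_add_half k
  have g1 := Real.Gamma_pos_of_pos hk
  have g2 := Real.Gamma_pos_of_pos (show 0 < k + 1 / 2 by linarith)
  have g3 := Real.Gamma_pos_of_pos (show 0 < 2 * k by linarith)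
  have h5 : (4 : ℝ) ^ (k - 1) = (2 : ℝ) ^ (2 * k - 1) / 2 := by
    rw [show (4 : ℝ) = 2 ^ (2 : ℝ) by norm_num, ← Real.rpow_mul (by norm_num),
      show 2 * (k - 1) = (2 * k - 1) - 1 by ring, Real.rpow_sub_one (by norm_num)]
  have h6 : (2 : ℝ) ^ (2 * k - 1) * (2 : ℝ) ^ (1 - 2 * k) = 1 := by
    rw [← Real.rpow_add (by norm_num)]; simp
  rw [h5, eq_div_iff g2.ne']
  calc _ = (2 : ℝ) ^ (2 * k - 1) * Real.Gamma k / Real.Gamma (2 * k) *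
        (Real.Gamma k * Real.Gamma (k + 1 / 2)) := by ring
    _ = ((2 : ℝ) ^ (2 * k - 1) * (2 : ℝ) ^ (1 - 2 * k)) * (√π * Real.Gamma k) *
        (Real.Gamma (2 * k) / Real.Gamma (2 * k)) := by rw [h4]; ring
    _ = _ := by rw [h6, div_self g3.ne']; ring

lemma aux_int (k : ℝ) (hk : 0 < k) :
    IntervalIntegrable (fun u : ℝ => (1 - u ^ 2) ^ (k - 1)) MeasureTheory.volume (-1) 1 := by
  by_contra h
  have h1 := intervalIntegral.integral_undef h
  rw [aux_B k hk] at h1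
  have g1 := Real.Gamma_pos_of_pos hk
  have g2 := Real.Gamma_pos_of_pos (show 0 < k + 1 / 2 by linarith)
  have g3 := Real.sqrt_pos.2 Real.pi_pos
  have : 0 < √π * Real.Gamma k / Real.Gamma (k + 1 / 2) := by positivity
  linarith

lemma aux_ratio (k : ℝ) (hk : 0 < k) (x₁ x₂ : ℝ) (m : ℕ) :
      JackP k m 0 x₁ x₂ / JackP k m 0 1 1 =
        (Real.Gamma (k + 1 / 2) / (Real.sqrt Real.pi * Real.Gamma k)) *
          ∫ u in (-1 : ℝ)..1,
            ((x₁ + x₂) / 2 + u * (x₁ - x₂) / 2) ^ m * (1 - u ^ 2) ^ (k - 1) := by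
  have hm : (0 : ℝ) ≤ m := Nat.cast_nonneg m
  have g1 := Real.Gamma_pos_of_pos hk
  have g2 := Real.Gamma_pos_of_pos (show 0 < m + k by linarith)
  have g3 := Real.Gamma_pos_of_pos (show 0 < m + 2 * k by linarith)
  have hc : Real.Gamma (m + 2 * k) / ((2 : ℝ) ^ (2 * k - 1) * Real.Gamma k * Real.Gamma (m + k))
    ≠ 0 := by positivity
  have h11 : ∫ u in (-1 : ℝ)..1, (((1 : ℝ) + 1) / 2 + u * (1 - 1) / 2) ^ m * (1 - u ^ 2) ^ (k - 1)
      = Real.sqrt Real.pi * Real.Gamma k / Real.Gamma (k + 1 / 2) := by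
    rw [← aux_B k hk]
    norm_num
  unfold JackP
  rw [h11, mul_div_mul_left _ _ hc, pow_zero, pow_zero, one_mul, one_mul, div_div_eq_mul_div]
  ring

lemma aux_Gamma (μ : ℝ) (hμ : 0 < μ) (m : ℕ) :
    Real.Gamma μ * μ ^ m ≤ Real.Gamma (μ + m) := by
  induction m with
  | zero => simp
  | succ n ih =>
    have hn : (0 : ℝ) ≤ n := Nat.cast_nonneg n
    have g := Real.Gamma_pos_of_pos hμ
    have : μ + ((n + 1 : ℕ) : ℝ) = (μ + n) + 1 := by push_cast; ring
    rw [this, Real.Gamma_add_one (by linarith), pow_succ']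
    calc _ = μ * (Real.Gamma μ * μ ^ n) := by ring
      _ ≤ _ := mul_le_mul (by linarith) ih (by positivity) (by linarith)

lemma aux_summ (μ : ℝ) (hμ : 0 < μ) (M : ℝ) (hM : 0 ≤ M) :
    Summable (fun m : ℕ =>
      (1 / ((Real.Gamma (μ + m) / Real.Gamma μ) * (m.factorial : ℝ))) * M ^ m) := by
  have g := Real.Gamma_pos_of_pos hμ
  refine Summable.of_nonneg_of_le (fun m => ?_) (fun m => ?_) (Real.summable_pow_div_factorial (M / μ))
  · have := Real.Gamma_pos_of_pos (show 0 < μ + m by positivity)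
    positivity
  · have h := aux_Gamma μ hμ m
    have h1 : μ ^ m ≤ Real.Gamma (μ + m) / Real.Gamma μ := by
      rw [le_div_iff₀ g]; linarith
    rw [div_pow, one_div_mul_eq_div, div_div]
    gcongr

lemma aux_bessel (μ : ℝ) (hμ : 0 < μ) (y : ℝ) (hy : 0 ≤ y) :
    HasSum (fun m : ℕ => (1 / ((Real.Gamma (μ + m) / Real.Gamma μ) * (m.factorial : ℝ))) * y ^ m)
      (besselI (μ - 1) (Real.sqrt (4 * y))) := by
  have h := (aux_summ μ hμ y hy).hasSum
  convert! h using 1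
  unfold besselI
  rw [← tsum_mul_left]
  congr 1
  ext m
  have e : (√(4 * y) / 2) ^ (2 * m) = y ^ m := by
    rw [pow_mul, div_pow, Real.sq_sqrt (by positivity)]
    congr 1
    ring
  have g := Real.Gamma_pos_of_pos hμ
  have g2 := Real.Gamma_pos_of_pos (show 0 < μ + m by positivity)
  rw [e, show (m : ℝ) + (μ - 1) + 1 = μ + m by ring, show μ - 1 + 1 = μ by ring]
  field_simp

/-- Lemma 4: the `₀F₁` hypergeometric series at `y = e₁` as a Bessel integral. -/
theorem hypergeometric_at_e1_as_bessel_integral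
    (k μ : ℝ) (hk : 0 < k) (hμ : 0 < μ)
    (x₁ x₂ : ℝ) (hx₁ : 0 ≤ x₁) (hx₂ : 0 ≤ x₂) :
    (∑' m : ℕ,
        (1 / ((Real.Gamma (μ + m) / Real.Gamma μ) * (m.factorial : ℝ))) *
          (JackP k m 0 x₁ x₂ / JackP k m 0 1 1) =
      (Real.Gamma (k + 1 / 2) / (Real.Gamma k * Real.sqrt Real.pi)) *
        ∫ v in (-1 : ℝ)..1,
          besselI (μ - 1) (Real.sqrt (2 * (x₁ + x₂ + v * (x₁ - x₂)))) *
            (1 - v ^ 2) ^ (k - 1)) ∧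
    ∀ m : ℕ,
      JackP k m 0 x₁ x₂ / JackP k m 0 1 1 =
        (Real.Gamma (k + 1 / 2) / (Real.sqrt Real.pi * Real.Gamma k)) *
          ∫ u in (-1 : ℝ)..1,
            ((x₁ + x₂) / 2 + u * (x₁ - x₂) / 2) ^ m * (1 - u ^ 2) ^ (k - 1) := by
  refine ⟨?_, aux_ratio k hk x₁ x₂⟩
  have key := intervalIntegral.hasSum_integral_of_dominated_convergence
    (μ := MeasureTheory.volume) (a := (-1 : ℝ)) (b := 1)
    (F := fun (m : ℕ) (v : ℝ) =>
      (1 / ((Real.Gamma (μ + m) / Real.Gamma μ) * (m.factorial : ℝ))) *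
        (((x₁ + x₂) / 2 + v * (x₁ - x₂) / 2) ^ m * (1 - v ^ 2) ^ (k - 1)))
    (f := fun v => besselI (μ - 1) (Real.sqrt (2 * (x₁ + x₂ + v * (x₁ - x₂)))) *
            (1 - v ^ 2) ^ (k - 1))
    (fun (m : ℕ) (v : ℝ) =>
      (1 / ((Real.Gamma (μ + m) / Real.Gamma μ) * (m.factorial : ℝ))) * (x₁ + x₂) ^ m *
        (1 - v ^ 2) ^ (k - 1))
    ?_ ?_ ?_ ?_ ?_
  · have key2 := key.tsum_eq
    rw [← key2, ← tsum_mul_left]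
    congr 1
    ext m
    rw [aux_ratio k hk, intervalIntegral.integral_const_mul]
    ring
  · intro m
    apply Measurable.aestronglyMeasurable
    fun_prop
  · intro m
    refine Filter.Eventually.of_forall fun v hv => ?_
    rw [Set.uIoc_of_le (by norm_num)] at hv
    have g := Real.Gamma_pos_of_pos hμ
    have g2 := Real.Gamma_pos_of_pos (show 0 < μ + m by positivity)
    have hv2 : 0 ≤ 1 - v ^ 2 := by nlinarith [hv.1, hv.2]
    have hy : 0 ≤ (x₁ + x₂) / 2 + v * (x₁ - x₂) / 2 := by nlinarith [hv.1, hv.2]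
    have hy2 : (x₁ + x₂) / 2 + v * (x₁ - x₂) / 2 ≤ x₁ + x₂ := by nlinarith [hv.1, hv.2]
    have hr := Real.rpow_nonneg hv2 (k - 1)
    rw [Real.norm_of_nonneg (by positivity), mul_assoc]
    gcongr
  · refine Filter.Eventually.of_forall fun v hv => ?_
    exact (aux_summ μ hμ (x₁ + x₂) (by positivity)).mul_right _
  · simp_rw [tsum_mul_right]
    exact (aux_int k hk).const_mul _
  · refine Filter.Eventually.of_forall fun v hv => ?_
    rw [Set.uIoc_of_le (by norm_num)] at hv
    have hy : 0 ≤ (x₁ + x₂) / 2 + v * (x₁ - x₂) / 2 := by nlinarith [hv.1, hv.2]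
    have h := (aux_bessel μ hμ _ hy).mul_right ((1 - v ^ 2) ^ (k - 1))
    rw [show 4 * ((x₁ + x₂) / 2 + v * (x₁ - x₂) / 2) = 2 * (x₁ + x₂ + v * (x₁ - x₂)) by ring] at h
    simpa only [mul_assoc] using! h
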